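/- arXiv:2510.05959 — 2 statements merged into one kernel-verified Lean document; each statement's English description precedes it below -/
import Mathlib

section
/- Let N, m be positive natural numbers, P an m×m real symmetric matrix, A an m×m real matrix, B an m×1 real matrix, γ > 0, and λ₁ ≤ λ₂ ≤ … ≤ λ_N real numbers. Suppose P·A + Aᵀ·P − 2λ₁·P·B·Bᵀ·P + γ·I_m is negative semidefinite. Let Λ = diag(λ₁, …, λ_N). Then I_N ⊗ (P·A + Aᵀ·P) − 2·Λ ⊗ (P·B·Bᵀ·P) + γ·I_{Nm} is negative semidefinite; equivalently, I_N ⊗ (P·A + Aᵀ·P) − (Λ + Λᵀ) ⊗ (P·B·Bᵀ·P) ⪯ −γ·I_{Nm}. -/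
open Matrix Kronecker

/-- A real matrix `M` is negative semidefinite if `xᵀMx ≤ 0` for all vectors `x`. -/
def Matrix.NegSemidef' {n : Type*} [Fintype n] (M : Matrix n n ℝ) : Prop :=
  ∀ x : n → ℝ, x ⬝ᵥ M.mulVec x ≤ 0

/-- The quadratic form of `diag(d) ⊗ M` is the `d`-weighted sum of the forms of `M` on the blocks. -/
theorem Matrix.dotProduct_diagonal_kronecker_mulVec {ι n : Type*} [Fintype ι] [DecidableEq ι]
    [Fintype n] (d : ι → ℝ) (M : Matrix n n ℝ) (x : ι × n → ℝ) :
    x ⬝ᵥ (diagonal d ⊗ₖ M) *ᵥ x =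
      ∑ i, d i * ((fun j => x (i, j)) ⬝ᵥ M *ᵥ fun j => x (i, j)) := by
  simp only [dotProduct, mulVec, Fintype.sum_prod_type, kroneckerMap_apply, diagonal_apply]
  refine Finset.sum_congr rfl fun i _ => ?_
  rw [Finset.mul_sum]
  refine Finset.sum_congr rfl fun j _ => ?_
  rw [Finset.sum_eq_single i (fun k _ hk => by simp [hk.symm]) (by simp)]
  simp only [if_true, Finset.mul_sum]
  exact Finset.sum_congr rfl fun k _ => by ring

/-- For symmetric `P`, the matrix `P·B·Bᵀ·P` has a nonnegative quadratic form. -/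
theorem Matrix.IsSymm.dotProduct_mul_mul_transpose_mul_mulVec_nonneg {n k : Type*} [Fintype n]
    [Fintype k] {P : Matrix n n ℝ} (hP : P.IsSymm) (B : Matrix n k ℝ) (y : n → ℝ) :
    0 ≤ y ⬝ᵥ (P * B * Bᵀ * P) *ᵥ y := by
  have hfactor : P * B * Bᵀ * P = (P * B) * (P * B)ᴴ := by
    rw [conjTranspose_eq_transpose_of_trivial, transpose_mul, hP.eq, Matrix.mul_assoc (P * B)]
  rw [hfactor]
  simpa using (posSemidef_self_mul_conjTranspose (P * B)).dotProduct_mulVec_nonneg y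

/-- If `P·A + Aᵀ·P − 2λ₁·P·B·Bᵀ·P + γ·I_m ⪯ 0` with `λ₁ ≤ λ₂ ≤ ⋯ ≤ λ_N` and
`Λ = diag(λ₁, …, λ_N)`, then `I_N ⊗ (P·A + Aᵀ·P) − 2·Λ ⊗ (P·B·Bᵀ·P) + γ·I_{Nm} ⪯ 0`. -/
theorem kron_riccati_negSemidef (N m : ℕ) (hN : 0 < N) (hm : 0 < m)
    (P A : Matrix (Fin m) (Fin m) ℝ) (B : Matrix (Fin m) (Fin 1) ℝ)
    (hP : P.IsSymm) (γ : ℝ) (hγ : 0 < γ)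
    (lam : Fin N → ℝ) (hmono : Monotone lam)
    (h : (P * A + Aᵀ * P - (2 * lam ⟨0, hN⟩) • (P * B * Bᵀ * P) + γ • 1).NegSemidef') :
    ((1 : Matrix (Fin N) (Fin N) ℝ) ⊗ₖ (P * A + Aᵀ * P) -
        (2 : ℝ) • ((Matrix.diagonal lam) ⊗ₖ (P * B * Bᵀ * P)) +
        γ • (1 : Matrix (Fin N × Fin m) (Fin N × Fin m) ℝ)).NegSemidef' := by
  intro x
  have hone : (1 : Matrix (Fin N × Fin m) (Fin N × Fin m) ℝ) =
      diagonal (fun _ : Fin N => (1 : ℝ)) ⊗ₖ (1 : Matrix (Fin m) (Fin m) ℝ) := by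
    rw [diagonal_one, one_kronecker_one]
  rw [hone, ← diagonal_one]
  simp only [add_mulVec, sub_mulVec, smul_mulVec, dotProduct_add, dotProduct_sub, dotProduct_smul,
    dotProduct_diagonal_kronecker_mulVec, smul_eq_mul, Finset.mul_sum, ← Finset.sum_add_distrib,
    ← Finset.sum_sub_distrib]
  refine Finset.sum_nonpos fun i _ => ?_
  have hblock := h fun j => x (i, j)
  have hle : lam ⟨0, hN⟩ ≤ lam i := hmono (Fin.mk_le_of_le_val (Nat.zero_le _))
  have hmul := mul_le_mul_of_nonneg_right hle
    (hP.dotProduct_mul_mul_transpose_mul_mulVec_nonneg B fun j => x (i, j))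
  simp only [add_mulVec, sub_mulVec, smul_mulVec, dotProduct_add, dotProduct_sub, dotProduct_smul,
    smul_eq_mul] at hblock ⊢
  linarith
end

section
/- Let m be a positive natural number, M an m×m real matrix, P an m×m real symmetric positive definite matrix, and γ > 0. If P·M + Mᵀ·P + γ·I_m is negative semidefinite, then every complex eigenvalue of M (i.e., every root of the characteristic polynomial of M over ℂ) has strictly negative real part; that is, M is Hurwitz. -/
open Matrix Polynomial

/-- A complex root of the characteristic polynomial of a real matrix yields a nonzero pair of real
vectors, the real and imaginary parts of a complex eigenvector. -/
theorem Matrix.exists_real_imag_eigenvector {n : Type*} [Fintype n] [DecidableEq n]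
    {M : Matrix n n ℝ} {μ : ℂ} (hμ : (M.charpoly.map (algebraMap ℝ ℂ)).IsRoot μ) :
    ∃ a b : n → ℝ, (a ≠ 0 ∨ b ≠ 0) ∧
      M *ᵥ a = μ.re • a - μ.im • b ∧ M *ᵥ b = μ.re • b + μ.im • a := by
  rw [← charpoly_map, IsRoot.def, eval_charpoly, ← exists_mulVec_eq_zero_iff] at hμ
  obtain ⟨v, hv, hMv⟩ := hμ
  have key : ∀ i, ∑ j, (M i j : ℂ) * v j = μ * v i := fun i => by
    have := congrFun hMv i
    simp only [sub_mulVec, scalar_apply, Pi.sub_apply, mulVec_diagonal, Pi.zero_apply,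
      sub_eq_zero] at this
    simpa [mulVec, dotProduct] using this.symm
  refine ⟨fun i => (v i).re, fun i => (v i).im, ?_, ?_, ?_⟩
  · by_contra! hab
    exact hv (funext fun i => Complex.ext (congrFun hab.1 i) (congrFun hab.2 i))
  · ext i
    simpa [mulVec, dotProduct] using congrArg Complex.re (key i)
  · ext i
    simpa [mulVec, dotProduct, add_comm] using congrArg Complex.im (key i)

/-- The quadratic form of `P * M + Mᵀ * P + γ • 1` for symmetric `P`. -/
theorem Matrix.IsSymm.dotProduct_lyapunov_mulVec {n : Type*} [Fintype n] [DecidableEq n]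
    {P : Matrix n n ℝ} (hP : P.IsSymm) (M : Matrix n n ℝ) (γ : ℝ) (x : n → ℝ) :
    x ⬝ᵥ (P * M + Mᵀ * P + γ • 1) *ᵥ x = 2 * (M *ᵥ x ⬝ᵥ P *ᵥ x) + γ * (x ⬝ᵥ x) := by
  have h₁ : x ⬝ᵥ P *ᵥ (M *ᵥ x) = M *ᵥ x ⬝ᵥ P *ᵥ x := by
    rw [dotProduct_mulVec, ← mulVec_transpose, hP.eq, dotProduct_comm]
  have h₂ : x ⬝ᵥ Mᵀ *ᵥ (P *ᵥ x) = M *ᵥ x ⬝ᵥ P *ᵥ x := by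
    rw [dotProduct_mulVec, vecMul_transpose]
  simp only [add_mulVec, dotProduct_add, ← mulVec_mulVec, h₁, h₂, smul_mulVec, one_mulVec,
    dotProduct_smul, smul_eq_mul]
  ring

/-- Lyapunov stability criterion: if `P` is symmetric positive definite, `γ > 0`, and
`P·M + Mᵀ·P + γ·I` is negative semidefinite, then every complex eigenvalue of `M`
(every root of its characteristic polynomial over `ℂ`) has strictly negative real part,
i.e. `M` is Hurwitz. -/
theorem lyapunov_implies_hurwitz (m : ℕ) (hm : 0 < m)
    (M P : Matrix (Fin m) (Fin m) ℝ) (hPsymm : P.IsSymm) (hPpd : P.PosDef)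
    (γ : ℝ) (hγ : 0 < γ)
    (h : (P * M + Mᵀ * P + γ • 1).NegSemidef') :
    ∀ μ : ℂ, (M.charpoly.map (algebraMap ℝ ℂ)).IsRoot μ → μ.re < 0 := by
  intro μ hμ
  obtain ⟨a, b, hab, ha, hb⟩ := exists_real_imag_eigenvector hμ
  have hQa := h a
  have hQb := h b
  rw [hPsymm.dotProduct_lyapunov_mulVec, ha] at hQa
  rw [hPsymm.dotProduct_lyapunov_mulVec, hb] at hQb
  have hcross : b ⬝ᵥ P *ᵥ a = a ⬝ᵥ P *ᵥ b := by
    rw [dotProduct_mulVec, ← mulVec_transpose, hPsymm.eq, dotProduct_comm]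
  simp only [sub_dotProduct, add_dotProduct, smul_dotProduct, smul_eq_mul, hcross] at hQa hQb
  have hPa : 0 ≤ a ⬝ᵥ P *ᵥ a := hPpd.posSemidef.dotProduct_mulVec_nonneg a
  have hPb : 0 ≤ b ⬝ᵥ P *ᵥ b := hPpd.posSemidef.dotProduct_mulVec_nonneg b
  have hnorm : 0 < a ⬝ᵥ a + b ⬝ᵥ b := by
    have ha₀ : 0 ≤ a ⬝ᵥ a := dotProduct_star_self_nonneg a
    have hb₀ : 0 ≤ b ⬝ᵥ b := dotProduct_star_self_nonneg b
    rcases hab with ha' | hb'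
    · exact add_pos_of_pos_of_nonneg (ha₀.lt_of_ne' (dotProduct_self_eq_zero.not.mpr ha')) hb₀
    · exact add_pos_of_nonneg_of_pos ha₀ (hb₀.lt_of_ne' (dotProduct_self_eq_zero.not.mpr hb'))
  by_contra! hre
  nlinarith [mul_pos hγ hnorm, mul_nonneg hre (add_nonneg hPa hPb)]
end
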